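/- Let v_RF be the supremum of val(x) over all reroutable s-t-flows x, let v_SRF be the supremum of val(x) over all strictly reroutable s-t-flows x, and let c be the infimum of cap(R,C) over all R-cuts (R,C). Then v_RF ≤ c ≤ 2·v_SRF ≤ 2·v_RF. -/

import Mathlib

open scoped BigOperators

variable {V A : Type}

/-- `IsWalk tl hd v w L`: the list of arcs `L` forms a walk from `v` to `w`
in the digraph whose arcs `a` go from `tl a` to `hd a`. -/
def IsWalk (tl hd : A → V) : V → V → List A → Prop
  | v, w, [] => v = w
  | v, w, a :: L => tl a = v ∧ IsWalk tl hd (hd a) w L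

/-- A simple path from `v` to `w`: a walk visiting no vertex twice. -/
def IsPath (tl hd : A → V) (v w : V) (L : List A) : Prop :=
  IsWalk tl hd v w L ∧ (v :: L.map hd).Nodup

/-- `Before L b a`: the list `L` traverses `b` (strictly) before `a`. -/
def Before (L : List A) (b a : A) : Prop :=
  ∃ l₁ l₂ l₃ : List A, L = l₁ ++ b :: (l₂ ++ a :: l₃)

/-- Sum of a path-flow over a set of paths. -/
noncomputable def sumOver (x : List A → ℝ) (S : Set (List A)) : ℝ :=
  ∑ᶠ P ∈ S, x P

/-- Flow value `x(a)` on an arc `a`: total flow on `s`-`t`-paths through `a`. -/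
noncomputable def arcFlow (tl hd : A → V) (s t : V) (x : List A → ℝ) (a : A) : ℝ :=
  sumOver x {P | IsPath tl hd s t P ∧ a ∈ P}

/-- The value of a flow: total flow on all `s`-`t`-paths. -/
noncomputable def flowVal (tl hd : A → V) (s t : V) (x : List A → ℝ) : ℝ :=
  sumOver x {P | IsPath tl hd s t P}

/-- An `s`-`t`-(path-)flow: nonnegative, supported on simple `s`-`t`-paths,
respecting the arc capacities `u`. -/
def IsFlow (tl hd : A → V) (s t : V) (u : A → ℝ) (x : List A → ℝ) : Prop :=
  (∀ P, 0 ≤ x P) ∧ (∀ P, ¬ IsPath tl hd s t P → x P = 0) ∧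
    ∀ a : A, arcFlow tl hd s t x a ≤ u a

/-- Available capacity `ū_{x,b}(a)` of arc `a` after failure of arc `b`:
`u(a)` minus the flow on paths through `a` that do not traverse `b` before `a`. -/
noncomputable def availCap (tl hd : A → V) (s t : V) (u : A → ℝ) (x : List A → ℝ)
    (b a : A) : ℝ :=
  u a - sumOver x {P | IsPath tl hd s t P ∧ a ∈ P ∧ ¬ Before P b a}

/-- Arc flow of a rerouting flow `y` for failing arc `b`: `y` lives on
`tl b`-`t`-paths avoiding `b`. -/
noncomputable def reArcFlow (tl hd : A → V) (t : V) (b : A) (y : List A → ℝ) (a : A) : ℝ :=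
  sumOver y {Q | IsPath tl hd (tl b) t Q ∧ b ∉ Q ∧ a ∈ Q}

/-- Value of a rerouting flow `y` for failing arc `b`. -/
noncomputable def reVal (tl hd : A → V) (t : V) (b : A) (y : List A → ℝ) : ℝ :=
  sumOver y {Q | IsPath tl hd (tl b) t Q ∧ b ∉ Q}

/-- `y` is a rerouting of `x` for the failing arc `b`: a `tl b`-`t`-flow of value
`x(b)` in `(V, A ∖ {b})` with capacities `ū_{x,b}`. -/
def IsRerouting (tl hd : A → V) (s t : V) (u : A → ℝ) (x : List A → ℝ) (b : A)
    (y : List A → ℝ) : Prop :=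
  (∀ Q, 0 ≤ y Q) ∧
  (∀ Q, ¬ (IsPath tl hd (tl b) t Q ∧ b ∉ Q) → y Q = 0) ∧
  (∀ a : A, a ≠ b → reArcFlow tl hd t b y a ≤ availCap tl hd s t u x b a) ∧
  reVal tl hd t b y = arcFlow tl hd s t x b

/-- `y` is a strict rerouting of `x` for the failing arc `b`: a `tl b`-`t`-flow
of value `x(b)` in `(V, A ∖ {b})` with `y(a) ≤ u(a) - x(a)` for all `a ≠ b`. -/
def IsStrictRerouting (tl hd : A → V) (s t : V) (u : A → ℝ) (x : List A → ℝ) (b : A)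
    (y : List A → ℝ) : Prop :=
  (∀ Q, 0 ≤ y Q) ∧
  (∀ Q, ¬ (IsPath tl hd (tl b) t Q ∧ b ∉ Q) → y Q = 0) ∧
  (∀ a : A, a ≠ b → reArcFlow tl hd t b y a ≤ u a - arcFlow tl hd s t x a) ∧
  reVal tl hd t b y = arcFlow tl hd s t x b

/-- `x` is reroutable: a rerouting exists for every failing arc. -/
def Reroutable (tl hd : A → V) (s t : V) (u : A → ℝ) (x : List A → ℝ) : Prop :=
  ∀ b : A, ∃ y : List A → ℝ, IsRerouting tl hd s t u x b y

/-- `x` is strictly reroutable: a strict rerouting exists for every failing arc. -/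
def StrictlyReroutable (tl hd : A → V) (s t : V) (u : A → ℝ) (x : List A → ℝ) : Prop :=
  ∀ b : A, ∃ y : List A → ℝ, IsStrictRerouting tl hd s t u x b y

/-- A `v`-`w`-cut: a (finite) set of arcs meeting every simple `v`-`w`-path. -/
def IsCut (tl hd : A → V) (v w : V) (C : Finset A) : Prop :=
  ∀ L : List A, IsPath tl hd v w L → ∃ a ∈ C, a ∈ L

/-- A `v`-`w`-cut in the digraph obtained by deleting the arcs in `Del`. -/
def IsCutIn (tl hd : A → V) (v w : V) (Del : Finset A) (S : Finset A) : Prop :=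
  Disjoint S Del ∧
    ∀ L : List A, IsPath tl hd v w L → (∀ a ∈ L, a ∉ Del) → ∃ a ∈ S, a ∈ L

/-- Minimum capacity of a `v`-`w`-cut in the digraph with the arcs of `Del` deleted. -/
noncomputable def minCutCap (tl hd : A → V) (v w : V) (u : A → ℝ) (Del : Finset A) : ℝ :=
  sInf {c : ℝ | ∃ S : Finset A, IsCutIn tl hd v w Del S ∧ c = ∑ a ∈ S, u a}

/-- An R-cut: a set `R` of arcs with, for each `a ∈ R`, a `tl a`-`t`-cut `C a` containing `a`. -/
def IsRCut (tl hd : A → V) (t : V) (R : Finset A) (C : A → Finset A) : Prop :=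
  ∀ a ∈ R, a ∈ C a ∧ IsCut tl hd (tl a) t (C a)

/-- Capacity of an R-cut: `φ(R,C) + ∑_{a ∈ R} u(C_a ∖ {a})`, where `φ(R,C)` is the
minimum capacity of an `s`-`t`-cut after deleting all arcs of `⋃_{a ∈ R} C_a`. -/
noncomputable def rcutCap [DecidableEq A] (tl hd : A → V) (s t : V) (u : A → ℝ)
    (R : Finset A) (C : A → Finset A) : ℝ :=
  minCutCap tl hd s t u (R.biUnion C) + ∑ a ∈ R, ∑ a' ∈ (C a).erase a, u a'

section Helpers

lemma isPath_nodup {tl hd : A → V} {v w : V} {L : List A} (h : IsPath tl hd v w L) : L.Nodup :=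
  List.Nodup.of_map hd (List.nodup_cons.1 h.2).2

lemma finite_paths [Fintype A] (tl hd : A → V) (v w : V) : {P | IsPath tl hd v w P}.Finite := by
  classical
  have : {l : List A | l.Nodup}.Finite := by
    apply (List.finite_length_le A (Fintype.card A)).subset
    intro l hl
    exact List.Nodup.length_le_card hl
  exact this.subset fun P hP => isPath_nodup hP

/-- finset of paths -/
noncomputable def pathFin [Fintype A] (tl hd : A → V) (v w : V) : Finset (List A) :=
  (finite_paths tl hd v w).toFinset

lemma mem_pathFin [Fintype A] {tl hd : A → V} {v w : V} {P : List A} :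
    P ∈ pathFin tl hd v w ↔ IsPath tl hd v w P := by
  simp [pathFin]

open Classical in
lemma sumOver_eq [Fintype A] (tl hd : A → V) (v w : V) (x : List A → ℝ) (S : Set (List A))
    (hS : ∀ P ∈ S, IsPath tl hd v w P) :
    sumOver x S = ∑ P ∈ pathFin tl hd v w, if P ∈ S then x P else 0 := by
  unfold sumOver
  have hfin : S.Finite := (finite_paths tl hd v w).subset hS
  rw [finsum_mem_eq_finite_toFinset_sum _ hfin, ← Finset.sum_filter]
  apply Finset.sum_congr _ fun _ _ => rfl
  ext P
  simp only [Set.Finite.mem_toFinset, Finset.mem_filter, mem_pathFin]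
  exact ⟨fun h => ⟨hS P h, h⟩, fun h => h.2⟩

lemma flowVal_eq [Fintype A] (tl hd : A → V) (v w : V) (x : List A → ℝ) :
    flowVal tl hd v w x = ∑ P ∈ pathFin tl hd v w, x P := by
  classical
  unfold flowVal
  rw [sumOver_eq tl hd v w x {P | IsPath tl hd v w P} (fun P h => h)]
  apply Finset.sum_congr rfl
  intro P hP
  rw [if_pos]
  exact mem_pathFin.1 hP

open Classical in
lemma arcFlow_eq [Fintype A] [DecidableEq A] (tl hd : A → V) (v w : V) (x : List A → ℝ) (a : A) :
    arcFlow tl hd v w x a = ∑ P ∈ pathFin tl hd v w, if a ∈ P then x P else 0 := by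
  unfold arcFlow
  rw [sumOver_eq tl hd v w x _ (fun P h => h.1)]
  apply Finset.sum_congr rfl
  intro P hP
  have := mem_pathFin.1 hP
  simp [this]

/-- value of vertex cut -/
noncomputable def cutv [Fintype A] [DecidableEq V] (tl hd : A → V) (k : A → ℝ) (U : Finset V) : ℝ :=
  ∑ e, if tl e ∈ U ∧ hd e ∉ U then k e else 0

lemma walk_cross {tl hd : A → V} (U : Finset V) {w : V} (hw : w ∉ U) (L : List A) :
    ∀ v, v ∈ U → IsWalk tl hd v w L → ∃ a ∈ L, tl a ∈ U ∧ hd a ∉ U := by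
  induction L with
  | nil => intro v hv h; exact absurd (h ▸ hv) hw
  | cons a L ih =>
    intro v hv h
    by_cases ha : hd a ∈ U
    · obtain ⟨b, hb, h2⟩ := ih _ ha h.2
      exact ⟨b, List.mem_cons_of_mem _ hb, h2⟩
    · exact ⟨a, List.mem_cons_self, by rw [h.1]; exact hv, ha⟩

lemma walk_count [Fintype A] [DecidableEq A] [DecidableEq V] {tl hd : A → V} (U : Finset V) {w : V}
    (L : List A) :
    ∀ v, IsWalk tl hd v w L → (∀ a ∈ L, tl a ∉ U → hd a ∉ U) →
      cutv tl hd (fun e => if e ∈ L then 1 else 0) U ≤ if v ∈ U then 1 else 0 := by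
  induction L with
  | nil => intro v hv h; simp [cutv]; split_ifs <;> norm_num
  | cons a L ih =>
    intro v h hent
    have ih' := ih _ h.2 (fun b hb => hent b (List.mem_cons_of_mem _ hb))
    have h1 : cutv tl hd (fun e => if e ∈ a :: L then (1:ℝ) else 0) U ≤
        (if tl a ∈ U ∧ hd a ∉ U then 1 else 0) + cutv tl hd (fun e => if e ∈ L then 1 else 0) U := by
      have h2 : (if tl a ∈ U ∧ hd a ∉ U then (1:ℝ) else 0) =
          ∑ e, if e = a then (if tl e ∈ U ∧ hd e ∉ U then (1:ℝ) else 0) else 0 := by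
        simp
      rw [h2, cutv, cutv, ← Finset.sum_add_distrib]
      apply Finset.sum_le_sum
      intro e _
      by_cases e1 : e = a <;> by_cases e2 : e ∈ L <;> by_cases e3 : (tl e ∈ U ∧ hd e ∉ U) <;>
        simp [e1, e2, e3] <;> split_ifs <;> norm_num
    have h3 := hent a List.mem_cons_self
    have h4 := h.1
    subst h4
    refine h1.trans ?_
    by_cases k1 : tl a ∈ U <;> by_cases k2 : hd a ∈ U <;> simp_all

lemma cutv_uncross [Fintype A] [DecidableEq A] [DecidableEq V] (tl hd : A → V) (k : A → ℝ)
    (hk : ∀ a, 0 ≤ k a) (U W : Finset V) (a : A) (h1 : tl a ∈ W) (h2 : tl a ∉ U)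
    (h3 : hd a ∈ U) (h4 : hd a ∉ W) :
    cutv tl hd k (U ∩ W) + cutv tl hd k (U ∪ W) + k a ≤ cutv tl hd k U + cutv tl hd k W := by
  have h : k a = ∑ e, if e = a then k e else 0 := by simp
  rw [h]
  unfold cutv
  rw [← Finset.sum_add_distrib, ← Finset.sum_add_distrib, ← Finset.sum_add_distrib]
  apply Finset.sum_le_sum
  intro e _
  have := hk e
  by_cases he : e = a
  · subst he; simp [h1, h2, h3, h4]
  · by_cases k1 : tl e ∈ U <;> by_cases k2 : tl e ∈ W <;> by_cases k3 : hd e ∈ U <;>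
      by_cases k4 : hd e ∈ W <;> simp [k1, k2, k3, k4, he, this]

lemma walk_append {tl hd : A → V} (L M : List A) : ∀ {v w z : V}, IsWalk tl hd v w L →
    IsWalk tl hd w z M → IsWalk tl hd v z (L ++ M) := by
  induction L with
  | nil => intro v w z h1 h2; cases h1; exact h2
  | cons a L ih => intro v w z h1 h2; exact ⟨h1.1, ih h1.2 h2⟩

lemma walk_split {tl hd : A → V} (L M : List A) : ∀ {v z : V}, IsWalk tl hd v z (L ++ M) →
    ∃ w, IsWalk tl hd v w L ∧ IsWalk tl hd w z M := by
  induction L with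
  | nil => intro v z h; exact ⟨v, rfl, h⟩
  | cons a L ih =>
    intro v z h
    obtain ⟨w, h1, h2⟩ := ih h.2
    exact ⟨w, ⟨h.1, h1⟩, h2⟩

lemma exists_path [Fintype A] [Fintype V] [DecidableEq V] (tl hd : A → V) (k : A → ℝ) (s t : V)
    (hk : ∀ a, 0 ≤ k a)
    (h : ∀ U : Finset V, s ∈ U → t ∉ U → 0 < cutv tl hd k U) :
    ∃ P, IsPath tl hd s t P ∧ ∀ a ∈ P, 0 < k a := by
  classical
  by_contra hcon
  let U : Finset V := Finset.univ.filter fun v => ∃ P, IsPath tl hd s v P ∧ ∀ a ∈ P, 0 < k a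
  have hs : s ∈ U := by
    simp only [U, Finset.mem_filter, Finset.mem_univ, true_and]
    exact ⟨[], ⟨rfl, by simp⟩, by simp⟩
  have ht : t ∉ U := by
    simp only [U, Finset.mem_filter, Finset.mem_univ, true_and]
    exact hcon
  have := h U hs ht
  apply this.ne'
  unfold cutv
  apply Finset.sum_eq_zero
  intro e _
  split_ifs with he
  · by_contra hne
    have hpos : 0 < k e := lt_of_le_of_ne (hk e) (Ne.symm hne)
    apply he.2
    have h1 := he.1
    simp only [U, Finset.mem_filter, Finset.mem_univ, true_and] at h1 ⊢
    obtain ⟨P, hP, hPk⟩ := h1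
    by_cases hmem : hd e ∈ s :: P.map hd
    · rcases List.mem_cons.1 hmem with h2 | h2
      · rw [h2]; exact ⟨[], ⟨rfl, by simp⟩, by simp⟩
      · obtain ⟨b, hb, hbe⟩ := List.mem_map.1 h2
        obtain ⟨l1, l2, rfl⟩ := List.append_of_mem hb
        have e1 : l1 ++ b :: l2 = (l1 ++ [b]) ++ l2 := by simp
        rw [e1] at hP
        refine ⟨l1 ++ [b], ⟨?_, ?_⟩, ?_⟩
        · obtain ⟨w, hw, _⟩ := walk_split l1 (b :: l2) (e1 ▸ hP.1)
          have hb2 := ‹IsWalk tl hd w _ (b :: l2)›.1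
          exact walk_append l1 [b] hw ⟨hb2, hbe⟩
        · have := hP.2
          rw [List.map_append, ← List.cons_append] at this
          exact this.of_append_left
        · intro a ha
          apply hPk
          rw [e1]; exact List.mem_append_left _ ha
    · refine ⟨P ++ [e], ⟨walk_append P [e] hP.1 ⟨rfl, rfl⟩, ?_⟩, ?_⟩
      · rw [List.map_append, ← List.cons_append]
        rw [List.nodup_append]
        refine ⟨hP.2, by simp, ?_⟩
        intro a ha b hb hab
        simp at hb
        subst hb; subst hab
        exact hmem ha
      · intro a ha
        rcases List.mem_append.1 ha with h | h
        · exact hPk a h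
        · simp at h; subst h; exact hpos
  · rfl

lemma cutv_sub [Fintype A] [DecidableEq V] (tl hd : A → V) (k d : A → ℝ) (ε : ℝ) (U : Finset V) :
    cutv tl hd (fun a => k a - ε * d a) U = cutv tl hd k U - ε * cutv tl hd d U := by
  unfold cutv
  rw [Finset.mul_sum, ← Finset.sum_sub_distrib]
  apply Finset.sum_congr rfl
  intro e _
  split_ifs <;> simp

lemma ev_pos (p q : ℝ) (hp : 0 < p) : ∀ᶠ ε in nhdsWithin (0:ℝ) (Set.Ioi 0), 0 < p - ε * q := by
  have : Filter.Tendsto (fun ε : ℝ => p - ε * q) (nhds 0) (nhds (p - 0 * q)) :=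
    Continuous.tendsto (by fun_prop) 0
  have h2 := this.eventually (lt_mem_nhds (a := 0) (by simpa using hp))
  exact h2.filter_mono nhdsWithin_le_nhds

/-- feasibility system used for max-flow min-cut -/
def Feas [Fintype A] [DecidableEq V] (tl hd : A → V) (s t : V) (u : A → ℝ) (r : ℝ)
    (x : List A → ℝ) (w : A → ℝ) : Prop :=
  (∀ P, 0 ≤ x P) ∧ (∀ P, ¬ IsPath tl hd s t P → x P = 0) ∧ (∀ a, 0 ≤ w a) ∧
  (∀ a, arcFlow tl hd s t x a + w a ≤ u a) ∧
  (∀ U : Finset V, s ∈ U → t ∉ U → r ≤ flowVal tl hd s t x + cutv tl hd w U) ∧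
  flowVal tl hd s t x ≤ r

lemma feas_min [Fintype A] [Fintype V] [DecidableEq V] (tl hd : A → V) (s t : V) (u : A → ℝ) (r : ℝ)
    (hu : ∀ a, 0 ≤ u a) (hr : 0 ≤ r)
    (hcut : ∀ U : Finset V, s ∈ U → t ∉ U → r ≤ cutv tl hd u U) :
    ∃ x w, Feas tl hd s t u r x w ∧ ∀ x' w', Feas tl hd s t u r x' w' → ∑ a, w a ≤ ∑ a, w' a := by
  classical
  let K : Set ((List A → ℝ) × (A → ℝ)) := {p | Feas tl hd s t u r p.1 p.2}
  have hK : IsCompact K := by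
    have hbox : IsCompact ((Set.pi Set.univ fun _ : List A => Set.Icc (0:ℝ) r) ×ˢ
        (Set.pi Set.univ fun a : A => Set.Icc (0:ℝ) (u a))) :=
      (isCompact_univ_pi fun _ => isCompact_Icc).prod (isCompact_univ_pi fun _ => isCompact_Icc)
    apply hbox.of_isClosed_subset
    · have : K = (⋂ P, {p | 0 ≤ p.1 P}) ∩ ((⋂ P, ⋂ (_ : ¬ IsPath tl hd s t P), {p | p.1 P = 0}) ∩
        ((⋂ a, {p | 0 ≤ p.2 a}) ∩ ((⋂ a, {p | arcFlow tl hd s t p.1 a + p.2 a ≤ u a}) ∩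
        ((⋂ U : Finset V, ⋂ (_ : s ∈ U), ⋂ (_ : t ∉ U),
          {p | r ≤ flowVal tl hd s t p.1 + cutv tl hd p.2 U}) ∩
          {p | flowVal tl hd s t p.1 ≤ r})))) := by
        ext p
        simp [K, Feas]
      rw [this]
      simp only [arcFlow_eq, flowVal_eq, cutv]
      refine IsClosed.inter ?_ (IsClosed.inter ?_ (IsClosed.inter ?_ (IsClosed.inter ?_
        (IsClosed.inter ?_ ?_))))
      · exact isClosed_iInter fun P => isClosed_le (by fun_prop) (by fun_prop)
      · exact isClosed_iInter fun P => isClosed_iInter fun _ =>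
          isClosed_eq (by fun_prop) (by fun_prop)
      · exact isClosed_iInter fun P => isClosed_le (by fun_prop) (by fun_prop)
      · refine isClosed_iInter fun a => isClosed_le ?_ (by fun_prop)
        refine Continuous.add (continuous_finsetSum _ fun P _ => ?_) (by fun_prop)
        split_ifs <;> fun_prop
      · refine isClosed_iInter fun U => isClosed_iInter fun _ => isClosed_iInter fun _ =>
          isClosed_le (by fun_prop) ?_
        refine Continuous.add (by fun_prop) (continuous_finsetSum _ fun P _ => ?_)
        split_ifs <;> fun_prop
      · exact isClosed_le (by fun_prop) (by fun_prop)
    · rintro ⟨x, w⟩ ⟨h1, h2, h3, h4, h5, h6⟩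
      simp only at h1 h2 h3 h4 h5 h6
      refine ⟨?_, ?_⟩
      · intro P _
        refine ⟨h1 P, ?_⟩
        by_cases hP : IsPath tl hd s t P
        · rw [flowVal_eq] at h6
          exact (Finset.single_le_sum (fun P _ => h1 P) (mem_pathFin.2 hP)).trans h6
        · simp only [h2 P hP]; exact hr
      · intro a _
        refine ⟨h3 a, ?_⟩
        have : 0 ≤ arcFlow tl hd s t x a := by
          rw [arcFlow_eq]
          exact Finset.sum_nonneg fun P _ => by split_ifs <;> simp [h1]
        have := h4 a
        simp only
        linarith
  have hne : K.Nonempty := by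
    refine ⟨(0, u), ?_⟩
    refine ⟨by simp, by simp, hu, ?_, ?_, ?_⟩
    · intro a; simp [arcFlow_eq]
    · intro U h1 h2; simpa [flowVal_eq] using hcut U h1 h2
    · simpa [flowVal_eq] using hr
  obtain ⟨⟨x, w⟩, hm, hmin⟩ := hK.exists_isMinOn hne
    (f := fun p : (List A → ℝ) × (A → ℝ) => ∑ a, p.2 a) (Continuous.continuousOn (by fun_prop))
  exact ⟨x, w, hm, fun x' w' h => hmin (a := (x', w')) h⟩

theorem mfmc [Fintype A] [DecidableEq A] [Fintype V] [DecidableEq V] (tl hd : A → V) (s t : V)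
    (hst : s ≠ t) (u : A → ℝ) (r : ℝ)
    (hu : ∀ a, 0 ≤ u a) (hr : 0 ≤ r)
    (hcut : ∀ U : Finset V, s ∈ U → t ∉ U → r ≤ cutv tl hd u U) :
    ∃ x, IsFlow tl hd s t u x ∧ flowVal tl hd s t x = r := by
  classical
  obtain ⟨x, w, ⟨h1, h2, h3, h4, h5, h6⟩, hmin⟩ := feas_min tl hd s t u r hu hr hcut
  rcases h6.eq_or_lt with heq | hlt
  · exact ⟨x, ⟨h1, h2, fun a => by linarith [h4 a, h3 a]⟩, heq⟩
  exfalso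
  -- every support arc lies in a tight cut
  have htight : ∀ a, 0 < w a → ∃ U : Finset V, s ∈ U ∧ t ∉ U ∧
      r = flowVal tl hd s t x + cutv tl hd w U ∧ tl a ∈ U ∧ hd a ∉ U := by
    intro a ha
    by_contra hcon
    push Not at hcon
    let d : A → ℝ := fun e => if e = a then 1 else 0
    have ev1 := ev_pos (w a) 1 ha
    have ev2 : ∀ᶠ ε in nhdsWithin (0:ℝ) (Set.Ioi 0), ∀ U : Finset V, s ∈ U → t ∉ U →
        r ≤ flowVal tl hd s t x + cutv tl hd (fun e => w e - ε * d e) U := by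
      rw [Filter.eventually_all]
      intro U
      by_cases hs : s ∈ U; swap
      · simp [hs]
      by_cases ht : t ∉ U; swap
      · simp [ht]
      simp only [hs, ht, cutv_sub, not_false_eq_true, forall_true_left]
      rcases (h5 U hs ht).eq_or_lt with he | hl
      · have hz : cutv tl hd d U = 0 := by
          unfold cutv
          apply Finset.sum_eq_zero
          intro e _
          split_ifs with hc
          · simp only [d]
            rw [if_neg]
            rintro rfl
            exact hc.2 (hcon U hs ht he hc.1)
          · rfl
        filter_upwards with ε
        rw [hz]; linarith
      · filter_upwards [ev_pos _ (cutv tl hd d U) (sub_pos.2 hl)] with ε hε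
        linarith
    obtain ⟨ε, ⟨e1, e2⟩, e3⟩ := ((ev1.and ev2).and self_mem_nhdsWithin).exists
    have e3 : 0 < ε := e3
    have hF : Feas tl hd s t u r x (fun e => w e - ε * d e) := by
      refine ⟨h1, h2, ?_, ?_, e2, h6⟩
      · intro e
        by_cases he : e = a
        · subst he; simp only [d, if_true]; linarith
        · simp [d, he, h3]
      · intro e
        have : 0 ≤ d e := by simp only [d]; split_ifs <;> norm_num
        nlinarith [h4 e, mul_nonneg e3.le this]
    have := hmin _ _ hF
    rw [Finset.sum_sub_distrib, ← Finset.mul_sum] at this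
    simp [d] at this
    linarith
  obtain ⟨P, hP, hPw⟩ := exists_path tl hd w s t h3 fun U hs ht => by linarith [h5 U hs ht]
  let d : A → ℝ := fun e => if e ∈ P then 1 else 0
  have hd0 : ∀ e, 0 ≤ d e := fun e => by simp only [d]; split_ifs <;> norm_num
  have hPne : P ≠ [] := by
    rintro rfl; exact hst hP.1
  have ev0 := ev_pos (r - flowVal tl hd s t x) 1 (by linarith)
  have ev1 : ∀ᶠ ε in nhdsWithin (0:ℝ) (Set.Ioi 0), ∀ e, 0 ≤ w e - ε * d e := by
    rw [Filter.eventually_all]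
    intro e
    by_cases he : e ∈ P
    · filter_upwards [ev_pos (w e) (d e) (hPw e he)] with ε hε using hε.le
    · filter_upwards with ε
      simp [d, he, h3]
  have ev2 : ∀ᶠ ε in nhdsWithin (0:ℝ) (Set.Ioi 0), ∀ U : Finset V, s ∈ U → t ∉ U →
        r ≤ (flowVal tl hd s t x + ε) + cutv tl hd (fun e => w e - ε * d e) U := by
    rw [Filter.eventually_all]
    intro U
    by_cases hs : s ∈ U; swap
    · simp [hs]
    by_cases ht : t ∉ U; swap
    · simp [ht]
    simp only [hs, ht, cutv_sub, not_false_eq_true, forall_true_left]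
    rcases (h5 U hs ht).eq_or_lt with he | hl
    · have hz : cutv tl hd d U ≤ 1 := by
        have := walk_count (tl := tl) (hd := hd) U P s hP.1 ?_
        · rw [if_pos hs] at this; exact this
        · intro a ha k1 k2
          obtain ⟨W, w1, w2, w3, w4, w5⟩ := htight a (hPw a ha)
          have hun := cutv_uncross tl hd w h3 U W a w4 k1 k2 w5
          have c1 := h5 (U ∩ W) (by simp [hs, w1]) (by simp [ht])
          have c2 := h5 (U ∪ W) (by simp [hs]) (by simp [ht, w2])
          linarith [hPw a ha]
      filter_upwards [self_mem_nhdsWithin] with ε hε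
      have hε : 0 < ε := hε
      nlinarith
    · filter_upwards [ev_pos _ (cutv tl hd d U) (sub_pos.2 hl), self_mem_nhdsWithin] with ε hε hε'
      have hε' : 0 < ε := hε'
      linarith
  obtain ⟨ε, ⟨⟨e0, e1⟩, e2⟩, e3⟩ := (((ev0.and ev1).and ev2).and self_mem_nhdsWithin).exists
  have e3 : 0 < ε := e3
  let x' : List A → ℝ := fun Q => x Q + if Q = P then ε else 0
  have hval : flowVal tl hd s t x' = flowVal tl hd s t x + ε := by
    simp only [flowVal_eq, x', Finset.sum_add_distrib]
    simp [mem_pathFin, hP]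
  have harc : ∀ a, arcFlow tl hd s t x' a = arcFlow tl hd s t x a + ε * d a := by
    intro a
    have hs : ε * d a = ∑ Q ∈ pathFin tl hd s t, if Q = P then ε * d a else 0 := by
      simp [mem_pathFin, hP]
    rw [arcFlow_eq, arcFlow_eq, hs, ← Finset.sum_add_distrib]
    apply Finset.sum_congr rfl
    intro Q _
    by_cases hQ : Q = P
    · subst hQ; by_cases ha : a ∈ Q <;> simp [x', d, ha]
    · simp [x', hQ]
  have hF : Feas tl hd s t u r x' (fun e => w e - ε * d e) := by
    refine ⟨?_, ?_, e1, ?_, ?_, ?_⟩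
    · intro Q
      have := h1 Q
      simp only [x']; split_ifs <;> linarith
    · intro Q hQ
      have : Q ≠ P := by rintro rfl; exact hQ hP
      simp [x', this, h2 Q hQ]
    · intro a; rw [harc]; linarith [h4 a]
    · intro U hs ht; rw [hval]; exact e2 U hs ht
    · rw [hval]; linarith
  have := hmin _ _ hF
  rw [Finset.sum_sub_distrib, ← Finset.mul_sum] at this
  obtain ⟨a, ha⟩ := List.exists_mem_of_ne_nil P hPne
  have hge : d a ≤ ∑ e, d e := Finset.single_le_sum (fun e _ => hd0 e) (Finset.mem_univ a)
  have : d a = 1 := by simp [d, ha]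
  nlinarith

open Classical in
lemma reVal_eq [Fintype A] [DecidableEq A] (tl hd : A → V) (t : V) (b : A) (y : List A → ℝ) :
    reVal tl hd t b y = ∑ P ∈ pathFin tl hd (tl b) t, if b ∉ P then y P else 0 := by
  unfold reVal
  rw [sumOver_eq tl hd (tl b) t y _ (fun P h => h.1)]
  apply Finset.sum_congr rfl
  intro P hP
  have := mem_pathFin.1 hP
  simp [this]

open Classical in
lemma reArcFlow_eq [Fintype A] [DecidableEq A] (tl hd : A → V) (t : V) (b : A) (y : List A → ℝ) (a : A) :
    reArcFlow tl hd t b y a =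
      ∑ P ∈ pathFin tl hd (tl b) t, if b ∉ P ∧ a ∈ P then y P else 0 := by
  unfold reArcFlow
  rw [sumOver_eq tl hd (tl b) t y _ (fun P h => h.1)]
  apply Finset.sum_congr rfl
  intro P hP
  have := mem_pathFin.1 hP
  simp [this]

open Classical in
lemma availCap_eq [Fintype A] [DecidableEq A] (tl hd : A → V) (s t : V) (u : A → ℝ) (x : List A → ℝ) (b a : A) :
    availCap tl hd s t u x b a =
      u a - ∑ P ∈ pathFin tl hd s t, if a ∈ P ∧ ¬ Before P b a then x P else 0 := by
  unfold availCap
  rw [sumOver_eq tl hd s t x _ (fun P h => h.1)]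
  congr 1
  apply Finset.sum_congr rfl
  intro P hP
  have := mem_pathFin.1 hP
  simp [this]

lemma before_mem {L : List A} {b a : A} (h : Before L b a) : b ∈ L := by
  obtain ⟨l1, l2, l3, rfl⟩ := h
  simp

lemma strict_imp [Fintype A] {tl hd : A → V} {s t : V} {u : A → ℝ} {x : List A → ℝ}
    (hx : IsFlow tl hd s t u x) (h : StrictlyReroutable tl hd s t u x) :
    Reroutable tl hd s t u x := by
  classical
  intro b
  obtain ⟨y, h1, h2, h3, h4⟩ := h b
  refine ⟨y, h1, h2, fun a ha => (h3 a ha).trans ?_, h4⟩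
  rw [availCap_eq, arcFlow_eq]
  apply sub_le_sub_left
  apply Finset.sum_le_sum
  intro P _
  have := hx.1 P
  by_cases k1 : a ∈ P <;> by_cases k2 : Before P b a <;> simp [k1, k2, this]

lemma path_ne_nil {tl hd : A → V} {s t : V} (hst : s ≠ t) {P : List A}
    (hP : IsPath tl hd s t P) : P ≠ [] := by
  rintro rfl; exact hst hP.1

lemma weak_R [Fintype A] [DecidableEq A] {tl hd : A → V} {s t : V} {u : A → ℝ} {x : List A → ℝ}
    (b : A) (y : List A → ℝ) (hy : IsRerouting tl hd s t u x b y) (C : Finset A)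
    (hC : IsCut tl hd (tl b) t C) :
    arcFlow tl hd s t x b + ∑ e ∈ C.erase b, (u e - availCap tl hd s t u x b e)
      ≤ ∑ e ∈ C.erase b, u e := by
  classical
  obtain ⟨h1, h2, h3, h4⟩ := hy
  have : arcFlow tl hd s t x b ≤ ∑ e ∈ C.erase b, availCap tl hd s t u x b e := by
    rw [← h4]
    calc reVal tl hd t b y ≤ ∑ e ∈ C.erase b, reArcFlow tl hd t b y e := by
          simp only [reVal_eq, reArcFlow_eq]
          rw [Finset.sum_comm]
          apply Finset.sum_le_sum
          intro P hP
          have hn : ∀ e ∈ C.erase b, 0 ≤ (if b ∉ P ∧ e ∈ P then y P else 0) := by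
            intro e _; split_ifs <;> simp [h1]
          by_cases hb : b ∈ P
          · rw [if_neg (not_not.2 hb)]; exact Finset.sum_nonneg hn
          · rw [if_pos hb]
            obtain ⟨e, he, heP⟩ := hC P (mem_pathFin.1 hP)
            have hne : e ≠ b := by rintro rfl; exact hb heP
            have := Finset.single_le_sum hn (Finset.mem_erase.2 ⟨hne, he⟩)
            rw [if_pos ⟨hb, heP⟩] at this
            exact this
      _ ≤ _ := Finset.sum_le_sum fun e he => h3 e (Finset.mem_erase.1 he).1
  rw [Finset.sum_sub_distrib]
  linarith

lemma weak_duality [Fintype A] [DecidableEq A] {tl hd : A → V} {s t : V} (hst : s ≠ t)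
    {u : A → ℝ} {x : List A → ℝ}
    (hx : IsFlow tl hd s t u x) (h : Reroutable tl hd s t u x) (R : Finset A) (C : A → Finset A)
    (hRC : IsRCut tl hd t R C) : flowVal tl hd s t x ≤ rcutCap tl hd s t u R C := by
  classical
  unfold rcutCap
  rw [← sub_le_iff_le_add]
  apply le_csInf
  · refine ⟨_, Finset.univ \ R.biUnion C, ⟨Finset.sdiff_disjoint, ?_⟩, rfl⟩
    intro L hL hL2
    obtain ⟨a, ha⟩ := List.exists_mem_of_ne_nil L (path_ne_nil hst hL)
    exact ⟨a, by simpa using hL2 a ha, ha⟩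
  rintro _ ⟨S, ⟨_, hS⟩, rfl⟩
  rw [sub_le_iff_le_add]
  have key1 : ∑ e ∈ S, arcFlow tl hd s t x e ≤ ∑ e ∈ S, u e :=
    Finset.sum_le_sum fun e _ => hx.2.2 e
  have key2 : ∑ a ∈ R, (arcFlow tl hd s t x a +
      ∑ e ∈ (C a).erase a, (u e - availCap tl hd s t u x a e)) ≤
      ∑ a ∈ R, ∑ e ∈ (C a).erase a, u e := by
    apply Finset.sum_le_sum
    intro a ha
    obtain ⟨y, hy⟩ := h a
    exact weak_R a y hy (C a) (hRC a ha).2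
  refine le_trans ?_ (add_le_add key1 key2)
  simp only [availCap_eq, sub_sub_cancel, arcFlow_eq, flowVal_eq]
  simp only [Finset.sum_comm (t := pathFin tl hd s t), ← Finset.sum_add_distrib]
  apply Finset.sum_le_sum
  intro P hP
  have hxP := hx.1 P
  have n1 : ∀ e ∈ S, 0 ≤ (if e ∈ P then x P else 0) := by
    intro e _; split_ifs <;> simp [hxP]
  have n2 : ∀ a : A, 0 ≤ ∑ e ∈ (C a).erase a, (if e ∈ P ∧ ¬ Before P a e then x P else 0) := by
    intro a; exact Finset.sum_nonneg fun e _ => by split_ifs <;> simp [hxP]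
  have n3 : ∀ a ∈ R, 0 ≤ (if a ∈ P then x P else 0) +
      ∑ e ∈ (C a).erase a, (if e ∈ P ∧ ¬ Before P a e then x P else 0) := by
    intro a _; exact add_nonneg (by split_ifs <;> simp [hxP]) (n2 a)
  by_cases hh : ∀ a ∈ P, a ∉ R.biUnion C
  · obtain ⟨e, he, heP⟩ := hS P (mem_pathFin.1 hP) hh
    have := Finset.single_le_sum n1 he
    rw [if_pos heP] at this
    have := Finset.sum_nonneg n3
    linarith
  · push Not at hh
    obtain ⟨e, heP, heU⟩ := hh
    obtain ⟨a, haR, hea⟩ := Finset.mem_biUnion.1 heU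
    have s1 := Finset.single_le_sum n3 haR
    have s0 := Finset.sum_nonneg n1
    have : x P ≤ (if a ∈ P then x P else 0) +
      ∑ e ∈ (C a).erase a, (if e ∈ P ∧ ¬ Before P a e then x P else 0) := by
      by_cases haP : a ∈ P
      · rw [if_pos haP]; linarith [n2 a]
      · have hne : e ≠ a := by rintro rfl; exact haP heP
        have := Finset.single_le_sum (s := (C a).erase a)
          (f := fun e => if e ∈ P ∧ ¬ Before P a e then x P else 0)
          (fun e _ => by split_ifs <;> simp [hxP]) (Finset.mem_erase.2 ⟨hne, hea⟩)
        rw [if_pos ⟨heP, fun hB => haP (before_mem hB)⟩] at this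
        rw [if_neg haP]; linarith
    linarith

lemma rcutCap_nonneg [Fintype A] [DecidableEq A] {tl hd : A → V} {s t : V}
    {u : A → ℝ} (hu : ∀ a, 0 ≤ u a) (R : Finset A) (C : A → Finset A) :
    0 ≤ rcutCap tl hd s t u R C := by
  unfold rcutCap minCutCap
  refine add_nonneg (Real.sInf_nonneg ?_)
    (Finset.sum_nonneg fun a _ => Finset.sum_nonneg fun e _ => hu e)
  rintro _ ⟨S, _, rfl⟩
  exact Finset.sum_nonneg fun e _ => hu e

lemma cutv_nonneg [Fintype A] [DecidableEq V] {tl hd : A → V} {k : A → ℝ} (hk : ∀ a, 0 ≤ k a)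
    (U : Finset V) : 0 ≤ cutv tl hd k U :=
  Finset.sum_nonneg fun e _ => by split_ifs <;> simp [hk]

lemma exists_min_cut [Fintype A] [Fintype V] [DecidableEq V] (tl hd : A → V) (s t : V)
    (hst : s ≠ t) (k : A → ℝ) :
    ∃ U : Finset V, s ∈ U ∧ t ∉ U ∧ ∀ U' : Finset V, s ∈ U' → t ∉ U' →
      cutv tl hd k U ≤ cutv tl hd k U' := by
  obtain ⟨U, hU, hm⟩ := Finset.exists_min_image
    (Finset.univ.filter fun U : Finset V => s ∈ U ∧ t ∉ U) (cutv tl hd k)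
    ⟨{s}, by simp [Ne.symm hst]⟩
  simp only [Finset.mem_filter, Finset.mem_univ, true_and] at hU hm
  exact ⟨U, hU.1, hU.2, fun U' h1 h2 => hm U' ⟨h1, h2⟩⟩

lemma arcFlow_nonneg [Fintype A] {tl hd : A → V} {s t : V} {x : List A → ℝ}
    (hx : ∀ P, 0 ≤ x P) (a : A) : 0 ≤ arcFlow tl hd s t x a := by
  classical
  rw [arcFlow_eq]
  exact Finset.sum_nonneg fun P _ => by split_ifs <;> simp [hx]

lemma cutv_half [Fintype A] [DecidableEq V] (tl hd : A → V) (k : A → ℝ) (U : Finset V) :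
    cutv tl hd (fun a => k a / 2) U = cutv tl hd k U / 2 := by
  unfold cutv
  rw [Finset.sum_div]
  apply Finset.sum_congr rfl
  intro e _
  split_ifs <;> simp

lemma strong [Fintype A] [DecidableEq A] [Fintype V] [DecidableEq V] (tl hd : A → V) (s t : V)
    (hst : s ≠ t) (u : A → ℝ) (hu : ∀ a, 0 ≤ u a) :
    ∃ x R C, IsFlow tl hd s t u x ∧ StrictlyReroutable tl hd s t u x ∧ IsRCut tl hd t R C ∧
      rcutCap tl hd s t u R C ≤ 2 * flowVal tl hd s t x := by
  classical
  let ub : A → A → ℝ := fun b => Function.update u b 0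
  have hub : ∀ b a, 0 ≤ ub b a := by
    intro b a
    simp only [ub, Function.update_apply]
    split_ifs <;> simp [hu]
  have hex : ∀ b : A, ∃ U : Finset V, tl b ≠ t → tl b ∈ U ∧ t ∉ U ∧
      ∀ U' : Finset V, tl b ∈ U' → t ∉ U' → cutv tl hd (ub b) U ≤ cutv tl hd (ub b) U' := by
    intro b
    by_cases hb : tl b = t
    · exact ⟨∅, fun h => absurd hb h⟩
    · obtain ⟨U, h⟩ := exists_min_cut tl hd (tl b) t hb (ub b)
      exact ⟨U, fun _ => h⟩
  choose Ub hUb using hex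
  let lam : A → ℝ := fun b => cutv tl hd (ub b) (Ub b)
  have hlam : ∀ b, 0 ≤ lam b := fun b => cutv_nonneg (hub b) _
  let k : A → ℝ := fun b => if tl b = t then 0 else min (u b) (lam b)
  have hk : ∀ a, 0 ≤ k a := by
    intro a; simp only [k]; split_ifs <;> simp [hu, hlam]
  have hku : ∀ a, k a ≤ u a := by
    intro a; simp only [k]; split_ifs <;> simp [hu]
  obtain ⟨U, hsU, htU, hUmin⟩ := exists_min_cut tl hd s t hst k
  obtain ⟨x, hx, hval⟩ := mfmc tl hd s t hst (fun a => k a / 2) (cutv tl hd k U / 2)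
    (fun a => by linarith [hk a]) (by linarith [cutv_nonneg (tl := tl) (hd := hd) hk U])
    (fun U' h1 h2 => by rw [cutv_half]; linarith [hUmin U' h1 h2])
  have hxa : ∀ a, 0 ≤ arcFlow tl hd s t x a := arcFlow_nonneg hx.1
  refine ⟨x, Finset.univ.filter fun a => (tl a ∈ U ∧ hd a ∉ U) ∧ lam a < u a,
    fun a => insert a (Finset.univ.filter fun e => tl e ∈ Ub a ∧ hd e ∉ Ub a), ?_, ?_, ?_, ?_⟩
  · exact ⟨hx.1, hx.2.1, fun a => by have := hx.2.2 a; simp only at this; linarith [hk a, hku a]⟩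
  · intro b
    have hxb := hx.2.2 b
    simp only at hxb
    by_cases hb : tl b = t
    · have h0 : arcFlow tl hd s t x b = 0 := by
        simp only [k, if_pos hb] at hxb
        linarith [hxa b]
      refine ⟨fun _ => 0, by simp, by simp, ?_, ?_⟩
      · intro a _
        have := hx.2.2 a
        simp only at this
        simp only [reArcFlow_eq, ite_self, Finset.sum_const_zero]
        linarith [hk a, hku a]
      · simp only [reVal_eq, ite_self, Finset.sum_const_zero, h0]
    · obtain ⟨q1, q2, q3⟩ := hUb b hb
      obtain ⟨y, hy, hyval⟩ := mfmc tl hd (tl b) t hb (fun a => ub b a / 2)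
        (arcFlow tl hd s t x b) (fun a => by linarith [hub b a]) (hxa b)
        (fun U' h1 h2 => by
          rw [cutv_half]
          have := q3 U' h1 h2
          have hl : k b ≤ lam b := by simp [k, hb]
          simp only [lam] at hl
          linarith)
      have hyb : ∀ Q, IsPath tl hd (tl b) t Q → b ∈ Q → y Q = 0 := by
        intro Q hQ hbQ
        have h1 := hy.2.2 b
        simp only [ub, Function.update_self, zero_div] at h1
        rw [arcFlow_eq] at h1
        have := Finset.single_le_sum (f := fun P => if b ∈ P then y P else 0)
          (fun P _ => by split_ifs <;> simp [hy.1]) (mem_pathFin.2 hQ)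
        simp only [if_pos hbQ] at this
        linarith [hy.1 Q]
      refine ⟨y, hy.1, ?_, ?_, ?_⟩
      · intro Q hQ
        by_cases hQ1 : IsPath tl hd (tl b) t Q
        · apply hyb Q hQ1
          by_contra h; exact hQ ⟨hQ1, h⟩
        · exact hy.2.1 Q hQ1
      · intro a hab
        have h1 := hy.2.2 a
        simp only [ub, Function.update_of_ne hab] at h1
        have h2 := hx.2.2 a
        simp only at h2
        have h3 : reArcFlow tl hd t b y a = arcFlow tl hd (tl b) t y a := by
          rw [reArcFlow_eq, arcFlow_eq]
          apply Finset.sum_congr rfl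
          intro Q hQ
          by_cases hbQ : b ∈ Q
          · simp [hyb Q (mem_pathFin.1 hQ) hbQ]
          · simp [hbQ]
        rw [h3]
        linarith [hku a]
      · rw [← hyval, reVal_eq, flowVal_eq]
        apply Finset.sum_congr rfl
        intro Q hQ
        by_cases hbQ : b ∈ Q
        · simp [hyb Q (mem_pathFin.1 hQ) hbQ]
        · simp [hbQ]
  · intro a ha
    simp only [Finset.mem_filter, Finset.mem_univ, true_and] at ha
    have hat : tl a ≠ t := fun h => htU (h ▸ ha.1.1)
    obtain ⟨q1, q2, q3⟩ := hUb a hat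
    refine ⟨Finset.mem_insert_self _ _, ?_⟩
    intro L hL
    obtain ⟨e, he, h2⟩ := walk_cross (Ub a) q2 L _ q1 hL.1
    exact ⟨e, Finset.mem_insert_of_mem (by simpa using h2), he⟩
  · rw [hval]
    have e1 : 2 * (cutv tl hd k U / 2) = cutv tl hd k U := by ring
    rw [e1]
    set R := Finset.univ.filter fun a => (tl a ∈ U ∧ hd a ∉ U) ∧ lam a < u a with hR
    set C : A → Finset A := fun a =>
      insert a (Finset.univ.filter fun e => tl e ∈ Ub a ∧ hd e ∉ Ub a) with hC
    have p2 : ∑ a ∈ R, ∑ e ∈ (C a).erase a, u e = ∑ a ∈ R, lam a := by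
      apply Finset.sum_congr rfl
      intro a _
      simp only [lam, cutv, hC, ub]
      rw [Finset.erase_insert_eq_erase, ← Finset.sum_filter,
        ← Finset.sum_erase (a := a) _ (Function.update_self a (0:ℝ) u)]
      apply Finset.sum_congr rfl
      intro e he
      rw [Function.update_of_ne (Finset.mem_erase.1 he).1]
    have p1 : minCutCap tl hd s t u (R.biUnion C) ≤
        ∑ a ∈ (Finset.univ.filter fun a => tl a ∈ U ∧ hd a ∉ U) \ R, u a := by
      refine le_trans (csInf_le ⟨0, ?_⟩ ⟨(Finset.univ.filter fun a => tl a ∈ U ∧ hd a ∉ U) \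
        R.biUnion C, ⟨Finset.sdiff_disjoint, ?_⟩, rfl⟩) ?_
      · rintro _ ⟨S, _, rfl⟩
        exact Finset.sum_nonneg fun e _ => hu e
      · intro L hL hL2
        obtain ⟨e, he, h2⟩ := walk_cross U htU L _ hsU hL.1
        exact ⟨e, by simpa only [Finset.mem_sdiff, Finset.mem_filter, Finset.mem_univ, true_and]
          using ⟨h2, hL2 e he⟩, he⟩
      · apply Finset.sum_le_sum_of_subset_of_nonneg
        · apply Finset.sdiff_subset_sdiff (le_refl _)
          intro a ha
          exact Finset.mem_biUnion.2 ⟨a, ha, Finset.mem_insert_self _ _⟩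
        · intro e _ _; exact hu e
    unfold rcutCap
    rw [p2]
    refine (add_le_add_left p1 _).trans (le_of_eq ?_)
    have hsub : R ⊆ Finset.univ.filter fun a => tl a ∈ U ∧ hd a ∉ U := by
      intro a ha
      simp only [hR, Finset.mem_filter, Finset.mem_univ, true_and] at ha ⊢
      exact ha.1
    unfold cutv
    rw [← Finset.sum_filter, ← Finset.sum_sdiff hsub]
    congr 1
    · apply Finset.sum_congr rfl
      intro a ha
      simp only [hR, Finset.mem_sdiff, Finset.mem_filter, Finset.mem_univ, true_and] at ha
      have hat : tl a ≠ t := fun h => htU (h ▸ ha.1.1)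
      have : u a ≤ lam a := by
        by_contra hcon; exact ha.2 ⟨ha.1, not_le.1 hcon⟩
      simp [k, hat, this]
    · apply Finset.sum_congr rfl
      intro a ha
      simp only [hR, Finset.mem_filter, Finset.mem_univ, true_and] at ha
      have hat : tl a ≠ t := fun h => htU (h ▸ ha.1.1)
      simp [k, hat, ha.2.le]

lemma path_self {tl hd : A → V} {s : V} {P : List A} (h : IsPath tl hd s s P) : P = [] := by
  obtain ⟨h1, h2⟩ := h
  by_contra hne
  obtain ⟨L, a, rfl⟩ : ∃ L a, P = L ++ [a] :=
    ⟨_, _, (List.dropLast_append_getLast hne).symm⟩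
  obtain ⟨w, _, hw⟩ := walk_split L [a] h1
  have : hd a = s := hw.2
  simp [this] at h2

lemma loop_flow [Fintype A] {tl hd : A → V} {s : V} {u : A → ℝ} (hu : ∀ a, 0 ≤ u a) (n : ℝ)
    (hn : 0 ≤ n) : ∃ x, IsFlow tl hd s s u x ∧ StrictlyReroutable tl hd s s u x ∧
      n = flowVal tl hd s s x := by
  classical
  let x : List A → ℝ := fun P => if P = [] then n else 0
  have h0 : ∀ a, arcFlow tl hd s s x a = 0 := by
    intro a
    rw [arcFlow_eq]
    apply Finset.sum_eq_zero
    intro P hP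
    rw [path_self (mem_pathFin.1 hP)]
    simp
  have hnil : IsPath tl hd s s [] := ⟨rfl, by simp⟩
  refine ⟨x, ⟨?_, ?_, ?_⟩, ?_, ?_⟩
  · intro P; simp only [x]; split_ifs <;> simp [hn]
  · intro P hP
    have : P ≠ [] := by rintro rfl; exact hP hnil
    simp [x, this]
  · intro a; rw [h0]; exact hu a
  · intro b
    refine ⟨fun _ => 0, by simp, by simp, ?_, ?_⟩
    · intro a _
      simp only [reArcFlow_eq, ite_self, Finset.sum_const_zero, h0]
      linarith [hu a]
    · simp only [reVal_eq, ite_self, Finset.sum_const_zero, h0]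
  · rw [flowVal_eq]
    simp [x, mem_pathFin, hnil]

end Helpers

/-- With `vRF` the supremum of values of reroutable flows, `vSRF` the
supremum of values of strictly reroutable flows, and `c` the infimum of R-cut
capacities, we have `vRF ≤ c ≤ 2·vSRF ≤ 2·vRF`. -/
theorem reroutable_flow_cut_bounds_chain
    {V A : Type} [Fintype V] [DecidableEq V] [Fintype A] [DecidableEq A]
    (tl hd : A → V) (s t : V) (u : A → ℝ) (hu : ∀ a, 0 ≤ u a)
    (hcover : ∀ v : V, ∃ L : List A, IsPath tl hd s t L ∧ v ∈ s :: L.map hd)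
    (vRF vSRF c : ℝ)
    (hvRF : vRF = sSup {r : ℝ | ∃ x : List A → ℝ,
      IsFlow tl hd s t u x ∧ Reroutable tl hd s t u x ∧ r = flowVal tl hd s t x})
    (hvSRF : vSRF = sSup {r : ℝ | ∃ x : List A → ℝ,
      IsFlow tl hd s t u x ∧ StrictlyReroutable tl hd s t u x ∧ r = flowVal tl hd s t x})
    (hc : c = sInf {r : ℝ | ∃ (R : Finset A) (C : A → Finset A),
      IsRCut tl hd t R C ∧ r = rcutCap tl hd s t u R C}) :
    vRF ≤ c ∧ c ≤ 2 * vSRF ∧ 2 * vSRF ≤ 2 * vRF := by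
  have hbb : BddBelow {r : ℝ | ∃ (R : Finset A) (C : A → Finset A),
      IsRCut tl hd t R C ∧ r = rcutCap tl hd s t u R C} := by
    refine ⟨0, ?_⟩
    rintro _ ⟨R, C, _, rfl⟩
    exact rcutCap_nonneg hu R C
  have hne : {r : ℝ | ∃ (R : Finset A) (C : A → Finset A),
      IsRCut tl hd t R C ∧ r = rcutCap tl hd s t u R C}.Nonempty :=
    ⟨_, ∅, fun _ => ∅, by simp [IsRCut], rfl⟩
  by_cases hst : s = t
  · subst hst
    have hnb : ∀ S : Set ℝ, (∀ n : ℝ, 0 ≤ n → n ∈ S) → sSup S = 0 := by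
      intro S hS
      apply Real.sSup_of_not_bddAbove
      rintro ⟨M, hM⟩
      have := hM (hS (max M 0 + 1) (by positivity))
      linarith [le_max_left M 0]
    have e1 : vRF = 0 := by
      rw [hvRF]
      apply hnb
      intro n hn
      obtain ⟨x, h1, h2, h3⟩ := loop_flow (tl := tl) (hd := hd) (s := s) hu n hn
      exact ⟨x, h1, strict_imp h1 h2, h3⟩
    have e2 : vSRF = 0 := by
      rw [hvSRF]
      apply hnb
      intro n hn
      exact loop_flow hu n hn
    have e3 : c = 0 := by
      rw [hc]
      apply le_antisymm
      · apply csInf_le hbb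
        refine ⟨∅, fun _ => ∅, by simp [IsRCut], ?_⟩
        have : {c : ℝ | ∃ S : Finset A, IsCutIn tl hd s s ∅ S ∧ c = ∑ a ∈ S, u a} = ∅ := by
          ext r
          simp only [Set.mem_setOf_eq, Set.mem_empty_iff_false, iff_false]
          rintro ⟨S, hS, _⟩
          obtain ⟨a, _, ha⟩ := hS.2 [] ⟨rfl, by simp⟩ (by simp)
          simp at ha
        simp [rcutCap, minCutCap, this]
      · apply le_csInf hne
        rintro _ ⟨R, C, _, rfl⟩
        exact rcutCap_nonneg hu R C
    rw [e1, e2, e3]; simp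
  · have hweak : ∀ r ∈ {r : ℝ | ∃ x : List A → ℝ,
        IsFlow tl hd s t u x ∧ Reroutable tl hd s t u x ∧ r = flowVal tl hd s t x}, r ≤ c := by
      rintro _ ⟨x, h1, h2, rfl⟩
      rw [hc]
      apply le_csInf hne
      rintro _ ⟨R, C, h3, rfl⟩
      exact weak_duality hst h1 h2 R C h3
    have hsub : {r : ℝ | ∃ x : List A → ℝ,
        IsFlow tl hd s t u x ∧ StrictlyReroutable tl hd s t u x ∧ r = flowVal tl hd s t x} ⊆
        {r : ℝ | ∃ x : List A → ℝ,
        IsFlow tl hd s t u x ∧ Reroutable tl hd s t u x ∧ r = flowVal tl hd s t x} := by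
      rintro _ ⟨x, h1, h2, rfl⟩
      exact ⟨x, h1, strict_imp h1 h2, rfl⟩
    obtain ⟨x, R, C, h1, h2, h3, h4⟩ := strong tl hd s t hst u hu
    have hmem : flowVal tl hd s t x ∈ {r : ℝ | ∃ x : List A → ℝ,
        IsFlow tl hd s t u x ∧ StrictlyReroutable tl hd s t u x ∧ r = flowVal tl hd s t x} :=
      ⟨x, h1, h2, rfl⟩
    refine ⟨?_, ?_, ?_⟩
    · rw [hvRF]
      exact csSup_le ⟨_, hsub hmem⟩ hweak
    · have g1 : flowVal tl hd s t x ≤ vSRF := by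
        rw [hvSRF]
        exact le_csSup ⟨c, fun r hr => hweak r (hsub hr)⟩ hmem
      have g2 : c ≤ rcutCap tl hd s t u R C := by
        rw [hc]
        exact csInf_le hbb ⟨R, C, h3, rfl⟩
      linarith
    · have : vSRF ≤ vRF := by
        rw [hvSRF, hvRF]
        exact csSup_le_csSup ⟨c, hweak⟩ ⟨_, hmem⟩ hsub
      linarith
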